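/- Fix q > 1 and let b ∈ ℝ, c ≥ 0 and ν be a Lévy measure with I(q) = ∫_{x≥1} e^{qx/(q−1)} dν(x) < ∞. Assume that neither condition (i) nor condition (ii) holds. Then the equation F(u) = 0 has exactly one solution β ∈ ℝ, where F(u) = b + c/2 + c·u + ∫ ((eˣ−1)Y_u(x) − h(x)) dν(x) and Y_u(x) = (1 + (q−1)u(eˣ−1))^{1/(q−1)} if 1 + (q−1)u(eˣ−1) ≥ 0 and Y_u(x) = 0 otherwise. -/

import Mathlib

open MeasureTheory Filter Set
open scoped ENNReal

/-- The truncation function `h(x) = x · 1_{|x| ≤ 1}`. -/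
noncomputable def htrunc (x : ℝ) : ℝ := if |x| ≤ 1 then x else 0

/-- `Y_u(x) = (1 + (q-1)u(eˣ-1))^{1/(q-1)}` if `1 + (q-1)u(eˣ-1) ≥ 0`, else `0`. -/
noncomputable def Yq (q u x : ℝ) : ℝ :=
  if 0 ≤ 1 + (q - 1) * u * (Real.exp x - 1) then
    (1 + (q - 1) * u * (Real.exp x - 1)) ^ (1 / (q - 1))
  else 0

/-- `F(u) = b + c/2 + c·u + ∫ ((eˣ-1)Y_u(x) - h(x)) dν(x)`. -/
noncomputable def Fq (q b c : ℝ) (ν : Measure ℝ) (u : ℝ) : ℝ :=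
  b + c / 2 + c * u + ∫ x, ((Real.exp x - 1) * Yq q u x - htrunc x) ∂ν

/-- Condition (i): `c = 0`, `∫|h| dν < ∞`, `ν((-∞,0)) = 0`, `b - ∫ h dν ≥ 0`. -/
def CondI (b c : ℝ) (ν : Measure ℝ) : Prop :=
  c = 0 ∧ Integrable htrunc ν ∧ ν (Set.Iio 0) = 0 ∧ 0 ≤ b - ∫ x, htrunc x ∂ν

/-- Condition (ii): `c = 0`, `∫|h| dν < ∞`, `ν((0,∞)) = 0`, `b - ∫ h dν ≤ 0`. -/
def CondII (b c : ℝ) (ν : Measure ℝ) : Prop :=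
  c = 0 ∧ Integrable htrunc ν ∧ ν (Set.Ioi 0) = 0 ∧ b - ∫ x, htrunc x ∂ν ≤ 0

open scoped Topology

section Tilt

variable {Ω : Type*} [MeasurableSpace Ω] {ν : Measure Ω} {Y : ℝ → ℝ} {y h : Ω → ℝ} {c d : ℝ}

theorem mul_mono_comp_le (hY : Monotone Y) {u v : ℝ} (huv : u ≤ v) (z : ℝ) :
    z * Y (u * z) ≤ z * Y (v * z) := by
  rcases le_total 0 z with hz | hz
  · exact mul_le_mul_of_nonneg_left (hY (mul_le_mul_of_nonneg_right huv hz)) hz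
  · exact mul_le_mul_of_nonpos_left (hY (mul_le_mul_of_nonpos_right huv hz)) hz

theorem drift_nonpos_of_forall_tilt_neg (hY : Monotone Y) (hY0 : Y 0 = 1)
    (htop : Tendsto Y atTop atTop) (hbot : Tendsto Y atBot (𝓝 0)) (hc : 0 ≤ c)
    (hint : ∀ u : ℝ, Integrable (fun x => y x * Y (u * y x) - h x) ν)
    (hneg : ∀ u : ℝ, d + c * u + ∫ x, (y x * Y (u * y x) - h x) ∂ν < 0) :
    c = 0 ∧ Integrable h ν ∧ (∀ᵐ x ∂ν, y x ≤ 0) ∧ d - ∫ x, h x ∂ν ≤ 0 := by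
  have hYnn : ∀ t, 0 ≤ Y t := fun t => hY.le_of_tendsto hbot t
  set g : ℝ → Ω → ℝ := fun u x => y x * Y (u * y x) - h x with hg
  set K : ℝ := -(d + ∫ x, g 0 x ∂ν) with hK
  have hfint : ∀ n : ℕ, Integrable (fun x => g n x - g 0 x) ν :=
    fun n => (hint n).sub (hint 0)
  have hfnn : ∀ (n : ℕ) (x : Ω), 0 ≤ g n x - g 0 x := by
    intro n x
    have := mul_mono_comp_le hY (Nat.cast_nonneg (α := ℝ) n) (y x)
    simp only [hg]
    linarith
  have hbound : ∀ n : ℕ, c * n + ∫ x, (g n x - g 0 x) ∂ν ≤ K := by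
    intro n
    have h1 : d + c * n + ∫ x, g n x ∂ν < 0 := hneg n
    rw [integral_sub (hint n) (hint 0)]
    linarith
  have hIK : ∀ n : ℕ, ∫ x, (g n x - g 0 x) ∂ν ≤ K := fun n =>
    (le_add_of_nonneg_left (mul_nonneg hc n.cast_nonneg)).trans (hbound n)
  have hc0 : c = 0 := by
    by_contra hne
    have hcpos : 0 < c := lt_of_le_of_ne hc (Ne.symm hne)
    obtain ⟨n, hn⟩ := exists_nat_gt (K / c)
    have h1 := hbound n
    have h2 : 0 ≤ ∫ x, (g n x - g 0 x) ∂ν := integral_nonneg (hfnn n)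
    rw [div_lt_iff₀ hcpos] at hn
    linarith
  have hfatou : ∫⁻ x, liminf (fun n : ℕ => ENNReal.ofReal (g n x - g 0 x)) atTop ∂ν
      ≤ ENNReal.ofReal K := by
    refine (lintegral_liminf_le' fun n => (hfint n).aemeasurable.ennreal_ofReal).trans ?_
    refine liminf_le_of_le ⟨0, by simp⟩ fun b hb => ?_
    obtain ⟨n, hn⟩ := hb.exists
    refine hn.trans ?_
    rw [← ofReal_integral_eq_lintegral_ofReal (hfint n) (ae_of_all _ (hfnn n))]
    exact ENNReal.ofReal_le_ofReal (hIK n)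
  have hlim_meas : AEMeasurable
      (fun x => liminf (fun n : ℕ => ENNReal.ofReal (g n x - g 0 x)) atTop) ν := by
    simp only [liminf_eq_iSup_iInf_of_nat]
    exact AEMeasurable.iSup fun n => AEMeasurable.biInf _ (to_countable _)
      fun m _ => (hfint m).aemeasurable.ennreal_ofReal
  have hcast : Tendsto (fun n : ℕ => (n : ℝ)) atTop atTop := tendsto_natCast_atTop_atTop
  have hy : ∀ᵐ x ∂ν, y x ≤ 0 := by
    filter_upwards [ae_lt_top' hlim_meas (hfatou.trans_lt ENNReal.ofReal_lt_top).ne] with x hx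
    by_contra! hpos
    have h1 : Tendsto (fun n : ℕ => g n x - g 0 x) atTop atTop :=
      tendsto_atTop_add_const_right _ _ (tendsto_atTop_add_const_right _ _
        ((htop.comp (hcast.atTop_mul_const hpos)).const_mul_atTop hpos))
    exact hx.ne (ENNReal.tendsto_ofReal_atTop.comp h1).liminf_eq
  have hlim : ∀ x, y x ≤ 0 → Tendsto (fun n : ℕ => y x * Y (n * y x)) atTop (𝓝 0) := by
    intro x hx
    rcases hx.eq_or_lt with h0 | hlt
    · simp [h0]
    · simpa using (hbot.comp (hcast.atTop_mul_const_of_neg hlt)).const_mul (y x)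
  have hg0h : ∀ x, g 0 x + h x = y x := by
    intro x
    simp [hg, hY0]
  have hsubint : Integrable (fun x => (g 0 x + h x)) ν := by
    have hf : ∀ᵐ x ∂ν, Tendsto (fun n : ℕ => g 0 x - g n x) atTop (𝓝 (g 0 x + h x)) := by
      filter_upwards [hy] with x hx
      have := ((hlim x hx).sub_const (h x)).const_sub (g 0 x)
      simpa [hg, sub_eq_add_neg, add_comm] using this
    refine ⟨aestronglyMeasurable_of_tendsto_ae atTop
      (fun n : ℕ => ((hint 0).sub (hint n)).aestronglyMeasurable) hf, ?_⟩
    have hle : ∫⁻ x, ‖g 0 x + h x‖ₑ ∂ν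
        ≤ ∫⁻ x, liminf (fun n : ℕ => ENNReal.ofReal (g n x - g 0 x)) atTop ∂ν := by
      refine lintegral_mono_ae ?_
      filter_upwards [hf, hy] with x hx hyx
      have h1 : Tendsto (fun n : ℕ => ENNReal.ofReal (g n x - g 0 x)) atTop
          (𝓝 (ENNReal.ofReal (-(g 0 x + h x)))) := by
        refine ENNReal.tendsto_ofReal ?_
        simpa using hx.neg
      rw [h1.liminf_eq, hg0h, Real.enorm_eq_ofReal_abs, abs_of_nonpos hyx]
    exact hle.trans_lt (hfatou.trans_lt ENNReal.ofReal_lt_top)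
  have hyint : Integrable y ν := by simpa only [hg0h] using hsubint
  have hhint : Integrable h ν :=
    (hsubint.sub (hint 0)).congr (ae_of_all _ fun x => add_sub_cancel_left (g 0 x) (h x))
  refine ⟨hc0, hhint, hy, ?_⟩
  have hYint : ∀ u : ℝ, Integrable (fun x => y x * Y (u * y x)) ν := fun u =>
    ((hint u).add hhint).congr (ae_of_all _ fun x => sub_add_cancel _ (h x))
  have hconv : Tendsto (fun n : ℕ => ∫ x, y x * Y (n * y x) ∂ν) atTop (𝓝 (∫ _, (0 : ℝ) ∂ν)) := by
    refine tendsto_integral_of_dominated_convergence (fun x => |y x|)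
      (fun n => (hYint n).aestronglyMeasurable) hyint.abs ?_ ?_
    · intro n
      filter_upwards [hy] with x hx
      have hle : Y (n * y x) ≤ 1 := hY0 ▸ hY (mul_nonpos_of_nonneg_of_nonpos n.cast_nonneg hx)
      rw [Real.norm_eq_abs, abs_mul, abs_of_nonneg (hYnn _)]
      exact mul_le_of_le_one_right (abs_nonneg _) hle
    · filter_upwards [hy] with x hx using hlim x hx
  have hG : Tendsto (fun n : ℕ => d - ∫ x, h x ∂ν + ∫ x, y x * Y (n * y x) ∂ν) atTop
      (𝓝 (d - ∫ x, h x ∂ν)) := by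
    simpa using hconv.const_add (d - ∫ x, h x ∂ν)
  refine le_of_tendsto' hG fun n => ?_
  have h1 := hneg n
  rw [integral_sub (hYint n) hhint, hc0] at h1
  linarith

theorem drift_eq_zero_of_tilt_eq_zero (hY : Monotone Y) (hY0 : Y 0 = 1)
    (hstrict : ∀ s t, s < t → Y s = Y t → Y t = 0) (hc : 0 ≤ c)
    (hy0 : ∀ᵐ x ∂ν, y x ≠ 0)
    (hint : ∀ u : ℝ, Integrable (fun x => y x * Y (u * y x) - h x) ν)
    {u v : ℝ} (huv : u < v) (hv : 0 ≤ v)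
    (hu0 : d + c * u + ∫ x, (y x * Y (u * y x) - h x) ∂ν = 0)
    (hv0 : d + c * v + ∫ x, (y x * Y (v * y x) - h x) ∂ν = 0) :
    c = 0 ∧ Integrable h ν ∧ (∀ᵐ x ∂ν, y x ≤ 0) ∧ d - ∫ x, h x ∂ν = 0 := by
  have hle : ∀ x, y x * Y (u * y x) - h x ≤ y x * Y (v * y x) - h x := fun x =>
    sub_le_sub_right (mul_mono_comp_le hY huv.le (y x)) _
  have hIle := integral_mono (hint u) (hint v) hle
  have hc0 : c = 0 := by
    by_contra hne
    have hcpos : 0 < c := lt_of_le_of_ne hc (Ne.symm hne)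
    have := mul_lt_mul_of_pos_left huv hcpos
    linarith
  subst hc0
  have hae := (integral_eq_iff_of_ae_le (hint u) (hint v) (ae_of_all _ hle)).1 (by linarith)
  have key : ∀ᵐ x ∂ν, y x ≤ 0 ∧ Y (v * y x) = 0 := by
    filter_upwards [hae, hy0] with x hx hx0
    have hYeq : Y (u * y x) = Y (v * y x) := mul_left_cancel₀ hx0 (sub_left_injective hx)
    rcases hx0.lt_or_gt with hneg | hpos
    · exact ⟨hneg.le, hYeq ▸ hstrict _ _ (mul_lt_mul_of_neg_right huv hneg) hYeq.symm⟩
    · have h1 := hstrict _ _ (mul_lt_mul_of_pos_right huv hpos) hYeq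
      have h2 := hY (mul_nonneg hv hpos.le)
      rw [hY0, h1] at h2
      exact absurd h2 (by norm_num)
  have heq : (fun x => y x * Y (v * y x) - h x) =ᵐ[ν] fun x => -h x := by
    filter_upwards [key] with x hx
    simp [hx.2]
  refine ⟨rfl, ?_, key.mono fun x hx => hx.1, ?_⟩
  · simpa using ((hint v).congr heq).neg
  · rw [integral_congr_ae heq, integral_neg] at hv0
    linarith

theorem integral_tilt_neg_neg (u : ℝ) :
    -d + c * u + ∫ x, (-y x * Y (u * -y x) - -h x) ∂ν
      = -(d + c * -u + ∫ x, (y x * Y (-u * y x) - h x) ∂ν) := by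
  have : (fun x => -y x * Y (u * -y x) - -h x) = fun x => -(y x * Y (-u * y x) - h x) := by
    funext x
    rw [mul_neg, neg_mul u]
    ring
  rw [this, integral_neg]
  ring

theorem integrable_tilt_neg (hint : ∀ u : ℝ, Integrable (fun x => y x * Y (u * y x) - h x) ν)
    (u : ℝ) : Integrable (fun x => -y x * Y (u * -y x) - -h x) ν := by
  refine (hint (-u)).neg.congr (ae_of_all _ fun x => ?_)
  simp only [Pi.neg_apply, mul_neg, neg_mul]
  ring

end Tilt

/-- The function `t ↦ (1 + (q-1)t)₊^{1/(q-1)}`, so that `Y_u(x) = Y(u(eˣ-1))`. -/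
noncomputable def tiltFun (q t : ℝ) : ℝ := (max 0 (1 + (q - 1) * t)) ^ (1 / (q - 1))

theorem Yq_eq_tiltFun {q : ℝ} (hq : 1 < q) (u x : ℝ) :
    Yq q u x = tiltFun q (u * (Real.exp x - 1)) := by
  have hp : 1 / (q - 1) ≠ 0 := (one_div_pos.2 (sub_pos.2 hq)).ne'
  unfold Yq tiltFun
  rw [← mul_assoc]
  split_ifs with h
  · rw [max_eq_right h]
  · rw [max_eq_left (not_le.1 h).le, Real.zero_rpow hp]

theorem tiltFun_zero (q : ℝ) : tiltFun q 0 = 1 := by simp [tiltFun]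

theorem tiltFun_nonneg (q t : ℝ) : 0 ≤ tiltFun q t := Real.rpow_nonneg (le_max_left _ _) _

theorem monotone_tiltFun {q : ℝ} (hq : 1 < q) : Monotone (tiltFun q) := by
  intro s t hst
  have ha : 0 < q - 1 := sub_pos.2 hq
  unfold tiltFun
  gcongr

theorem continuous_tiltFun {q : ℝ} (hq : 1 < q) : Continuous (tiltFun q) :=
  Continuous.rpow_const (by fun_prop) fun _ => Or.inr (one_div_pos.2 (sub_pos.2 hq)).le

theorem tendsto_tiltFun_atTop {q : ℝ} (hq : 1 < q) : Tendsto (tiltFun q) atTop atTop := by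
  have ha : 0 < q - 1 := sub_pos.2 hq
  refine (tendsto_rpow_atTop (one_div_pos.2 ha)).comp ?_
  exact tendsto_atTop_mono (fun t => le_max_right _ _)
    (tendsto_atTop_add_const_left _ _ (tendsto_id.const_mul_atTop ha))

theorem tendsto_tiltFun_atBot {q : ℝ} (hq : 1 < q) : Tendsto (tiltFun q) atBot (𝓝 0) := by
  have ha : 0 < q - 1 := sub_pos.2 hq
  refine tendsto_const_nhds.congr' ?_
  filter_upwards [eventually_le_atBot (-1 / (q - 1))] with t ht
  have h1 : 1 + (q - 1) * t ≤ 0 := by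
    rw [le_div_iff₀ ha] at ht
    linarith
  rw [tiltFun, max_eq_left h1, Real.zero_rpow (one_div_pos.2 ha).ne']

theorem tiltFun_eq_zero_of_eq {q : ℝ} (hq : 1 < q) {s t : ℝ} (hst : s < t)
    (h : tiltFun q s = tiltFun q t) : tiltFun q t = 0 := by
  have ha : 0 < q - 1 := sub_pos.2 hq
  have hp := (one_div_pos.2 ha).ne'
  have h1 : max 0 (1 + (q - 1) * s) = max 0 (1 + (q - 1) * t) :=
    (Real.rpow_left_inj (le_max_left _ _) (le_max_left _ _) hp).1 h
  have h2 := mul_lt_mul_of_pos_left hst ha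
  have h3 : 1 + (q - 1) * t ≤ 0 := by
    by_contra! hpos
    rw [max_eq_right hpos.le] at h1
    rcases max_choice 0 (1 + (q - 1) * s) with h4 | h4 <;> linarith
  rw [tiltFun, max_eq_left h3, Real.zero_rpow hp]

theorem abs_rpow_sub_one_le_abs_pow_sub_one {t p : ℝ} (ht : 0 ≤ t) (hp : 0 ≤ p) {n : ℕ}
    (hpn : p ≤ n) : |t ^ p - 1| ≤ |t ^ n - 1| := by
  rcases le_total 1 t with h1 | h1
  · have h2 := Real.one_le_rpow h1 hp
    have h3 := Real.rpow_le_rpow_of_exponent_le h1 hpn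
    rw [Real.rpow_natCast] at h3
    rw [abs_of_nonneg (by linarith), abs_of_nonneg (by linarith)]
    linarith
  · have h2 := Real.rpow_le_one ht h1 hp
    have h3 : t ^ n ≤ t ^ p := by
      rcases ht.eq_or_lt with rfl | hpos
      · rcases Nat.eq_zero_or_pos n with rfl | hn
        · have : p = 0 := le_antisymm (by simpa using hpn) hp
          simp [this]
        · rw [zero_pow hn.ne']
          exact Real.rpow_nonneg le_rfl _
      · rw [← Real.rpow_natCast]
        exact Real.rpow_le_rpow_of_exponent_ge hpos h1 hpn
    rw [abs_of_nonpos (by linarith), abs_of_nonpos (by linarith)]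
    linarith

theorem abs_rpow_sub_one_le {t p T : ℝ} (ht : 0 ≤ t) (htT : t ≤ T) (hT : 1 ≤ T) (hp : 0 ≤ p) :
    |t ^ p - 1| ≤ ⌈p⌉₊ * T ^ (⌈p⌉₊ - 1) * |t - 1| := by
  refine (abs_rpow_sub_one_le_abs_pow_sub_one ht hp (Nat.le_ceil p)).trans ?_
  have h1 := abs_pow_sub_pow_le t 1 ⌈p⌉₊
  rw [one_pow] at h1
  refine h1.trans ?_
  have h2 : max |t| |1| ≤ T := by simp [abs_of_nonneg ht, htT, hT]
  have h3 : max |t| |1| ^ (⌈p⌉₊ - 1) ≤ T ^ (⌈p⌉₊ - 1) :=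
    pow_le_pow_left₀ (le_max_of_le_left (abs_nonneg _)) h2 _
  calc |t - 1| * ⌈p⌉₊ * max |t| |1| ^ (⌈p⌉₊ - 1)
      ≤ |t - 1| * ⌈p⌉₊ * T ^ (⌈p⌉₊ - 1) := by gcongr
    _ = _ := by ring

theorem tiltFun_le {q R u z w : ℝ} (hq : 1 < q) (hu : |u| ≤ R) (hz : |z| ≤ w) (hw : 1 ≤ w) :
    tiltFun q (u * z) ≤ (1 + (q - 1) * R) ^ (1 / (q - 1)) * w ^ (1 / (q - 1)) := by
  have ha : 0 < q - 1 := sub_pos.2 hq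
  have hR : 0 ≤ R := (abs_nonneg u).trans hu
  rw [← Real.mul_rpow (by positivity) (by positivity)]
  refine Real.rpow_le_rpow (le_max_left _ _) (max_le (by positivity) ?_) (by positivity)
  have h1 : u * z ≤ R * w := by
    calc u * z ≤ |u| * |z| := by rw [← abs_mul]; exact le_abs_self _
      _ ≤ R * w := by gcongr
  nlinarith [mul_le_mul_of_nonneg_left h1 ha.le]

theorem exists_abs_integrand_le {q R : ℝ} (hq : 1 < q) (hR : 0 ≤ R) :
    ∃ C : ℝ, ∀ u x : ℝ, |u| ≤ R →
      |(Real.exp x - 1) * tiltFun q (u * (Real.exp x - 1)) - htrunc x| ≤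
        C * (min (x ^ 2) 1 + (Ici (1 : ℝ)).indicator (fun x => Real.exp (q * x / (q - 1))) x) := by
  have ha : 0 < q - 1 := sub_pos.2 hq
  set p := 1 / (q - 1) with hp
  have hp0 : 0 < p := one_div_pos.2 ha
  set T := 1 + 2 * (q - 1) * R with hT
  have hT1 : 1 ≤ T := by
    have : 0 ≤ 2 * (q - 1) * R := by positivity
    linarith
  set K : ℝ := ⌈p⌉₊ * T ^ (⌈p⌉₊ - 1) with hK
  have hK0 : 0 ≤ K := by positivity
  set A := (1 + (q - 1) * R) ^ p with hA
  have hA0 : 0 ≤ A := by positivity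
  set B := 4 * K * (q - 1) * R + 1 with hB
  have hB0 : 0 ≤ B := by positivity
  refine ⟨B + A, fun u x hu => ?_⟩
  set z := Real.exp x - 1 with hz
  have hind : 0 ≤ (Ici (1 : ℝ)).indicator (fun x => Real.exp (q * x / (q - 1))) x :=
    indicator_nonneg (fun _ _ => (Real.exp_pos _).le) _
  have hmin : 0 ≤ min (x ^ 2) 1 := le_min (sq_nonneg x) zero_le_one
  rcases le_or_gt |x| 1 with hx | hx
  · have hzx : |z| ≤ 2 * |x| := Real.abs_exp_sub_one_le hx
    have hzx2 : |z - x| ≤ x ^ 2 := Real.abs_exp_sub_one_sub_id_le hx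
    have huz : |u * z| ≤ R * (2 * |x|) := by
      rw [abs_mul]
      gcongr
    have h1 : |max 0 (1 + (q - 1) * (u * z)) - 1| ≤ (q - 1) * (R * (2 * |x|)) := by
      have h2 : |max 0 (1 + (q - 1) * (u * z)) - 1| ≤ |(q - 1) * (u * z)| := by
        have := abs_max_sub_max_le_abs (1 + (q - 1) * (u * z)) 1 0
        rw [max_comm _ 0, max_eq_left (zero_le_one (α := ℝ))] at this
        simpa using this
      refine h2.trans ?_
      rw [abs_mul, abs_of_pos ha]
      gcongr
    have h2 : max 0 (1 + (q - 1) * (u * z)) ≤ T := by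
      have h3 := (le_abs_self _).trans h1
      have h4 : (q - 1) * (R * (2 * |x|)) ≤ (q - 1) * (R * (2 * 1)) := by gcongr
      rw [hT]
      linarith
    have h3 : |tiltFun q (u * z) - 1| ≤ K * ((q - 1) * (R * (2 * |x|))) :=
      (abs_rpow_sub_one_le (le_max_left _ _) h2 hT1 hp0.le).trans
        (mul_le_mul_of_nonneg_left h1 hK0)
    have h4 : |z * tiltFun q (u * z) - htrunc x| ≤ B * x ^ 2 := by
      have h5 : z * tiltFun q (u * z) - htrunc x = z * (tiltFun q (u * z) - 1) + (z - x) := by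
        rw [htrunc, if_pos hx]
        ring
      rw [h5]
      calc |z * (tiltFun q (u * z) - 1) + (z - x)|
          ≤ |z| * |tiltFun q (u * z) - 1| + |z - x| := by
            rw [← abs_mul]
            exact abs_add_le _ _
        _ ≤ 2 * |x| * (K * ((q - 1) * (R * (2 * |x|)))) + x ^ 2 := by gcongr
        _ = B * x ^ 2 := by
            rw [hB, ← sq_abs x]
            ring
    have h5 : min (x ^ 2) 1 = x ^ 2 :=
      min_eq_left (by rw [← sq_abs]; exact pow_le_one₀ (abs_nonneg x) hx)
    rw [h5] at hmin ⊢
    nlinarith [mul_nonneg hA0 hmin, mul_nonneg (add_nonneg hB0 hA0) hind]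
  · have hh : htrunc x = 0 := if_neg (not_le.2 hx)
    have hmin1 : min (x ^ 2) 1 = 1 := min_eq_right (by rw [← sq_abs]; exact one_le_pow₀ hx.le)
    rw [hh, sub_zero, abs_mul, abs_of_nonneg (tiltFun_nonneg _ _), hmin1]
    rcases lt_abs.1 hx with hx1 | hx1
    · have hex : 1 ≤ Real.exp x := Real.one_le_exp (by linarith)
      have hzle : |z| ≤ Real.exp x := by
        rw [abs_of_nonneg (by linarith)]
        linarith
      rw [indicator_of_mem (mem_Ici.2 hx1.le)] at hind ⊢
      have h1 : |z| * tiltFun q (u * z) ≤ Real.exp x * (A * Real.exp x ^ p) :=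
        mul_le_mul hzle (tiltFun_le hq hu hzle hex) (tiltFun_nonneg _ _) (by positivity)
      have h2 : Real.exp x * (A * Real.exp x ^ p) = A * Real.exp (q * x / (q - 1)) := by
        rw [← Real.exp_mul, mul_left_comm, ← Real.exp_add]
        congr 2
        rw [hp]
        field_simp
        ring
      nlinarith [mul_nonneg hB0 hind]
    · have hex : Real.exp x ≤ 1 := Real.exp_le_one_iff.2 (by linarith)
      have hzle : |z| ≤ 1 := by
        have := Real.exp_pos x
        rw [abs_of_nonpos (by linarith)]
        linarith
      have h1 : |z| * tiltFun q (u * z) ≤ 1 * (A * 1 ^ p) :=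
        mul_le_mul hzle (tiltFun_le hq hu hzle le_rfl) (tiltFun_nonneg _ _) zero_le_one
      rw [Real.one_rpow] at h1
      nlinarith [mul_nonneg (add_nonneg hB0 hA0) hind]

theorem integrable_min_sq_add_indicator_exp {q : ℝ} {ν : Measure ℝ}
    (hν : ∫⁻ x, ENNReal.ofReal (min (x ^ 2) 1) ∂ν < ⊤)
    (hI : ∫⁻ x in Set.Ici (1 : ℝ), ENNReal.ofReal (Real.exp (q * x / (q - 1))) ∂ν < ⊤) :
    Integrable (fun x => min (x ^ 2) 1 +
      (Ici (1 : ℝ)).indicator (fun x => Real.exp (q * x / (q - 1))) x) ν := by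
  refine Integrable.add ?_ ?_
  · exact ⟨by fun_prop, (hasFiniteIntegral_iff_ofReal
      (ae_of_all _ fun x => le_min (sq_nonneg x) zero_le_one)).2 hν⟩
  · rw [integrable_indicator_iff measurableSet_Ici]
    exact ⟨by fun_prop, (hasFiniteIntegral_iff_ofReal
      (ae_of_all _ fun x => (Real.exp_pos _).le)).2 hI⟩

theorem measurable_htrunc : Measurable htrunc :=
  Measurable.ite (measurableSet_le (by fun_prop) (by fun_prop)) measurable_id measurable_const

/-- existence/uniqueness of the root of `F`, Lemma 9: if neither
(i) nor (ii) holds, then `F(u) = 0` has exactly one real solution. -/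
theorem stmt_14 (q b c : ℝ) (hq : 1 < q) (hc : 0 ≤ c) (ν : Measure ℝ)
    (hν0 : ν {0} = 0)
    (hν : ∫⁻ x, ENNReal.ofReal (min (x ^ 2) 1) ∂ν < ⊤)
    (hI : ∫⁻ x in Set.Ici (1 : ℝ),
      ENNReal.ofReal (Real.exp (q * x / (q - 1))) ∂ν < ⊤)
    (hni : ¬ CondI b c ν) (hnii : ¬ CondII b c ν) :
    ∃! β : ℝ, Fq q b c ν β = 0 := by
  set y : ℝ → ℝ := fun x => Real.exp x - 1 with hy
  have hF : ∀ u, Fq q b c ν u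
      = (b + c / 2) + c * u + ∫ x, (y x * tiltFun q (u * y x) - htrunc x) ∂ν := by
    intro u
    simp only [Fq, Yq_eq_tiltFun hq, hy]
  have hdom := integrable_min_sq_add_indicator_exp hν hI
  have hYcont := continuous_tiltFun hq
  have hmeas : ∀ u : ℝ,
      AEStronglyMeasurable (fun x => y x * tiltFun q (u * y x) - htrunc x) ν := fun u =>
    (Continuous.aestronglyMeasurable (by fun_prop)).sub measurable_htrunc.aestronglyMeasurable
  have hint : ∀ u : ℝ, Integrable (fun x => y x * tiltFun q (u * y x) - htrunc x) ν := by
    intro u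
    obtain ⟨C, hC⟩ := exists_abs_integrand_le hq (abs_nonneg u)
    exact (hdom.const_mul C).mono' (hmeas u) (ae_of_all _ fun x => hC u x le_rfl)
  have hcont : Continuous (Fq q b c ν) := by
    rw [funext hF]
    refine Continuous.add (by fun_prop) (continuous_iff_continuousAt.2 fun u₀ => ?_)
    obtain ⟨C, hC⟩ := exists_abs_integrand_le hq (R := |u₀| + 1) (by positivity)
    refine continuousAt_of_dominated (Eventually.of_forall hmeas) ?_ (hdom.const_mul C)
      (ae_of_all _ fun x => Continuous.continuousAt (by fun_prop))
    have hev : ∀ᶠ u in 𝓝 u₀, |u| < |u₀| + 1 :=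
      continuous_abs.continuousAt.eventually_lt_const (lt_add_one _)
    filter_upwards [hev] with u hu
    exact ae_of_all _ fun x => hC u x hu.le
  have hmono := monotone_tiltFun hq
  have hY0 := tiltFun_zero q
  have htop := tendsto_tiltFun_atTop hq
  have hbot := tendsto_tiltFun_atBot hq
  have hstrict := fun s t => tiltFun_eq_zero_of_eq hq (s := s) (t := t)
  have hII : c = 0 ∧ Integrable htrunc ν ∧ (∀ᵐ x ∂ν, y x ≤ 0) ∧
      b + c / 2 - ∫ x, htrunc x ∂ν ≤ 0 → False := by
    rintro ⟨rfl, h1, h2, h3⟩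
    refine hnii ⟨rfl, h1, ?_, by linarith⟩
    refine measure_mono_null (fun x hx => ?_) (ae_iff.1 h2)
    simpa [hy] using hx
  have hI' : c = 0 ∧ Integrable (fun x => -htrunc x) ν ∧ (∀ᵐ x ∂ν, -y x ≤ 0) ∧
      -(b + c / 2) - ∫ x, -htrunc x ∂ν ≤ 0 → False := by
    rintro ⟨rfl, h1, h2, h3⟩
    rw [integral_neg] at h3
    refine hni ⟨rfl, by simpa using h1.neg, ?_, by linarith⟩
    refine measure_mono_null (fun x hx => ?_) (ae_iff.1 h2)
    simpa [hy] using hx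
  have huniq : ∀ u v, u < v → Fq q b c ν u = 0 → Fq q b c ν v = 0 → False := by
    intro u v huv hu hv
    have hy0 : ∀ᵐ x ∂ν, y x ≠ 0 := by
      refine measure_mono_null (fun x hx => ?_) hν0
      simpa [hy, sub_eq_zero] using hx
    rw [hF] at hu hv
    rcases le_or_gt 0 v with hv0 | hv0
    · obtain ⟨h1, h2, h3, h4⟩ := drift_eq_zero_of_tilt_eq_zero hmono hY0 hstrict hc hy0 hint
        huv hv0 hu hv
      exact hII ⟨h1, h2, h3, h4.le⟩
    · obtain ⟨h1, h2, h3, h4⟩ := drift_eq_zero_of_tilt_eq_zero (y := fun x => -y x)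
        (h := fun x => -htrunc x) (d := -(b + c / 2)) hmono hY0 hstrict hc
        (hy0.mono fun x hx => neg_ne_zero.2 hx) (integrable_tilt_neg hint)
        (neg_lt_neg huv) (by linarith)
        (by rw [integral_tilt_neg_neg, neg_neg, hv, neg_zero])
        (by rw [integral_tilt_neg_neg, neg_neg, hu, neg_zero])
      exact hI' ⟨h1, h2, h3, h4.le⟩
  have hpos : ∃ u, 0 ≤ Fq q b c ν u := by
    by_contra! hneg
    exact hII (drift_nonpos_of_forall_tilt_neg hmono hY0 htop hbot hc hint
      fun u => hF u ▸ hneg u)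
  have hneg : ∃ u, Fq q b c ν u ≤ 0 := by
    by_contra! hpos
    refine hI' (drift_nonpos_of_forall_tilt_neg hmono hY0 htop hbot hc
      (integrable_tilt_neg hint) fun u => ?_)
    rw [integral_tilt_neg_neg, ← hF]
    exact neg_neg_of_pos (hpos _)
  obtain ⟨u₁, h₁⟩ := hneg
  obtain ⟨u₂, h₂⟩ := hpos
  obtain ⟨β, hβ⟩ := mem_range_of_exists_le_of_exists_ge hcont ⟨u₁, h₁⟩ ⟨u₂, h₂⟩
  refine ⟨β, hβ, fun v hv => ?_⟩
  rcases lt_trichotomy v β with h | h | h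
  · exact (huniq v β h hv hβ).elim
  · exact h
  · exact (huniq β v h hβ hv).elim
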